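/- Let a : ℝ → ℝ be smooth and positive and K ∈ ℝ, and consider the Robertson–Walker metric g₀₀ = 1, g₁₁ = −a(t)²/(1−Kr²), g₂₂ = −a(t)²r², g₃₃ = −a(t)²r²sin²θ (off-diagonal entries zero) on the chart with 1 − Kr² > 0, r > 0, θ ∈ (0,π), with Christoffel symbols Γ^ρ_{βμ} = ½ g^{ρα}(∂_μ g_{βα} + ∂_β g_{μα} − ∂_α g_{βμ}) and curvature tensor R^σ_{μνρ} = ∂_ν Γ^σ_{μρ} − ∂_μ Γ^σ_{νρ} + Σ_α(Γ^α_{μρ}Γ^σ_{αν} − Γ^α_{νρ}Γ^σ_{αμ}). Then R^σ_{μνρ} = ψ^{σρ}(δ_{μσ}δ_{νρ} − δ_{μρ}δ_{νσ}), where ψ^{0σ} = (1 − δ_{0σ})(a''(t)/a(t)) g_{σσ} for σ = 0,1,2,3; ψ^{i0} = (1 − δ_{i0})(a''(t)/a(t)) g₀₀ for i = 1,2,3; and ψ^{ij} = (1 − δ_{ij})((a'(t)² + K)/a(t)²) g_{jj} for i,j = 1,2,3. -/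

import Mathlib

open Matrix

/-- Partial derivative ∂_μ F of a function of x ∈ ℝ⁴. -/
noncomputable def pdx (μ : Fin 4) (F : (Fin 4 → ℝ) → ℝ) (x : Fin 4 → ℝ) : ℝ :=
  fderiv ℝ F x (Pi.single μ 1)

/-- Christoffel symbols Γ^ρ_{βμ} = ½ Σ_α g^{ρα}(∂_μ g_{βα} + ∂_β g_{μα} − ∂_α g_{βμ})
of a metric g, with g^{ρα} the entries of the inverse metric matrix. -/
noncomputable def christoffel (g : (Fin 4 → ℝ) → Matrix (Fin 4) (Fin 4) ℝ)
    (x : Fin 4 → ℝ) (ρ β μ : Fin 4) : ℝ :=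
  (1 / 2) * ∑ α : Fin 4, (g x)⁻¹ ρ α *
    (pdx μ (fun y => g y β α) x + pdx β (fun y => g y μ α) x - pdx α (fun y => g y β μ) x)

/-- The curvature tensor R^σ_{μνρ} = ∂_ν Γ^σ_{μρ} − ∂_μ Γ^σ_{νρ}
+ Σ_α(Γ^α_{μρ}Γ^σ_{αν} − Γ^α_{νρ}Γ^σ_{αμ}); `riemann g x σ μ ν ρ` is R^σ_{μνρ}(x). -/
noncomputable def riemann (g : (Fin 4 → ℝ) → Matrix (Fin 4) (Fin 4) ℝ)
    (x : Fin 4 → ℝ) (σ μ ν ρ : Fin 4) : ℝ :=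
  pdx ν (fun y => christoffel g y σ μ ρ) x - pdx μ (fun y => christoffel g y σ ν ρ) x
    + ∑ α : Fin 4,
        (christoffel g x α μ ρ * christoffel g x σ α ν
          - christoffel g x α ν ρ * christoffel g x σ α μ)

/-- The Robertson–Walker metric g = diag(1, −a(t)²/(1−Kr²), −a(t)²r², −a(t)²r²sin²θ)
in coordinates (t,r,θ,φ) = (x⁰,x¹,x²,x³). -/
noncomputable def rwMetric (a : ℝ → ℝ) (K : ℝ) (x : Fin 4 → ℝ) :
    Matrix (Fin 4) (Fin 4) ℝ :=
  Matrix.diagonal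
    ![1, -(a (x 0)) ^ 2 / (1 - K * (x 1) ^ 2), -((a (x 0)) ^ 2 * (x 1) ^ 2),
      -((a (x 0)) ^ 2 * (x 1) ^ 2 * Real.sin (x 2) ^ 2)]

/-- Kronecker delta on Fin 4, valued in ℝ. -/
noncomputable def kd (a b : Fin 4) : ℝ := if a = b then 1 else 0

/-- The coefficients ψ^{σρ} of the curvature of the Robertson–Walker metric:
ψ^{0σ} = (1−δ_{0σ})(a''/a)g_{σσ}, ψ^{i0} = (1−δ_{i0})(a''/a)g₀₀,
ψ^{ij} = (1−δ_{ij})((a'²+K)/a²)g_{jj} for i,j = 1,2,3. -/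
noncomputable def rwPsi (a : ℝ → ℝ) (K : ℝ) (x : Fin 4 → ℝ) (σ ρ : Fin 4) : ℝ :=
  if σ = 0 then
    (1 - kd 0 ρ) * (deriv (deriv a) (x 0) / a (x 0)) * rwMetric a K x ρ ρ
  else if ρ = 0 then
    (1 - kd σ 0) * (deriv (deriv a) (x 0) / a (x 0)) * rwMetric a K x 0 0
  else
    (1 - kd σ ρ) * (((deriv a (x 0)) ^ 2 + K) / (a (x 0)) ^ 2) * rwMetric a K x ρ ρ

/-- Gradient of a product of functions of the first three coordinates separately. -/
theorem pdx_separable {f h k : ℝ → ℝ} {f' h' k' : ℝ} {x : Fin 4 → ℝ}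
    (hf : HasDerivAt f f' (x 0)) (hh : HasDerivAt h h' (x 1)) (hk : HasDerivAt k k' (x 2))
    (μ : Fin 4) :
    pdx μ (fun y => f (y 0) * h (y 1) * k (y 2)) x =
      ![f' * h (x 1) * k (x 2), f (x 0) * h' * k (x 2), f (x 0) * h (x 1) * k', 0] μ := by
  have p (i : Fin 4) : HasFDerivAt (fun y : Fin 4 → ℝ => y i)
      (ContinuousLinearMap.proj i : (Fin 4 → ℝ) →L[ℝ] ℝ) x := hasFDerivAt_apply i x
  have H := ((hf.comp_hasFDerivAt x (p 0)).mul (hh.comp_hasFDerivAt x (p 1))).mul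
    (hk.comp_hasFDerivAt x (p 2))
  unfold pdx
  refine (congrArg (fun L : (Fin 4 → ℝ) →L[ℝ] ℝ => L (Pi.single μ 1)) H.fderiv).trans ?_
  fin_cases μ <;> simp <;> ring

theorem pdx_congr_of_eventuallyEq {F G : (Fin 4 → ℝ) → ℝ} {x : Fin 4 → ℝ}
    (h : F =ᶠ[nhds x] G) (μ : Fin 4) : pdx μ F x = pdx μ G x := by
  rw [pdx, pdx, h.fderiv_eq]

@[simp] theorem pdx_const (μ : Fin 4) (c : ℝ) (x : Fin 4 → ℝ) : pdx μ (fun _ => c) x = 0 := by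
  simp [pdx]

/-- The domain of the Robertson–Walker chart. -/
def rwDomain (K : ℝ) : Set (Fin 4 → ℝ) :=
  {x | 0 < 1 - K * (x 1) ^ 2 ∧ 0 < x 1 ∧ x 2 ∈ Set.Ioo 0 Real.pi}

theorem isOpen_rwDomain (K : ℝ) : IsOpen (rwDomain K) := by
  have h (i : Fin 4) : Continuous fun x : Fin 4 → ℝ => x i := continuous_apply i
  exact (isOpen_lt continuous_const (continuous_const.sub (((h 1).pow 2).const_mul K))).inter
    ((isOpen_lt continuous_const (h 1)).inter (isOpen_Ioo.preimage (h 2)))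

/-- `rwMetricDeriv a K x μ β` is the partial derivative ∂_μ g_{ββ} of the metric. -/
noncomputable def rwMetricDeriv (a : ℝ → ℝ) (K : ℝ) (x : Fin 4 → ℝ) :
    Matrix (Fin 4) (Fin 4) ℝ :=
  let A := a (x 0)
  let A' := deriv a (x 0)
  let r := x 1
  let s := Real.sin (x 2)
  let c := Real.cos (x 2)
  let w := 1 - K * r ^ 2
  !![0, -(2 * A * A') / w, -(2 * A * A' * r ^ 2), -(2 * A * A' * r ^ 2 * s ^ 2);
     0, -(A ^ 2 * (2 * K * r)) / w ^ 2, -(A ^ 2 * (2 * r)), -(A ^ 2 * (2 * r) * s ^ 2);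
     0, 0, 0, -(A ^ 2 * r ^ 2 * (2 * s * c));
     0, 0, 0, 0]

/-- Closed form of the Christoffel symbols Γ^ρ_{βμ} of the Robertson–Walker metric. -/
noncomputable def rwChristoffel (a : ℝ → ℝ) (K : ℝ) (x : Fin 4 → ℝ) :
    Fin 4 → Matrix (Fin 4) (Fin 4) ℝ :=
  let A := a (x 0)
  let H := deriv a (x 0) / a (x 0)
  let A' := deriv a (x 0)
  let r := x 1
  let s := Real.sin (x 2)
  let c := Real.cos (x 2)
  let w := 1 - K * r ^ 2
  ![!![0, 0, 0, 0;
       0, A * A' / w, 0, 0;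
       0, 0, A * A' * r ^ 2, 0;
       0, 0, 0, A * A' * r ^ 2 * s ^ 2],
    !![0, H, 0, 0;
       H, K * r / w, 0, 0;
       0, 0, -(r * w), 0;
       0, 0, 0, -(r * w) * s ^ 2],
    !![0, 0, H, 0;
       0, 0, 1 / r, 0;
       H, 1 / r, 0, 0;
       0, 0, 0, -(s * c)],
    !![0, 0, 0, H;
       0, 0, 0, 1 / r;
       0, 0, 0, c / s;
       H, 1 / r, c / s, 0]]

theorem hasDerivAt_one_sub_mul_sq (K r : ℝ) :
    HasDerivAt (fun r => 1 - K * r ^ 2) (-(2 * K * r)) r :=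
  (((hasDerivAt_pow 2 r).const_mul K).const_sub 1).congr_deriv (by norm_num; ring)

theorem hasDerivAt_sin_sq (θ : ℝ) :
    HasDerivAt (fun θ => Real.sin θ ^ 2) (2 * Real.sin θ * Real.cos θ) θ :=
  ((Real.hasDerivAt_sin θ).pow 2).congr_deriv (by norm_num)

theorem hasDerivAt_sq (r : ℝ) : HasDerivAt (fun r : ℝ => r ^ 2) (2 * r) r := by
  simpa using hasDerivAt_pow 2 r

theorem pdx_rwMetric {a : ℝ → ℝ} {K : ℝ} (ha : Differentiable ℝ a) {x : Fin 4 → ℝ}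
    (hx : x ∈ rwDomain K) (μ β γ : Fin 4) :
    pdx μ (fun y => rwMetric a K y β γ) x = if β = γ then rwMetricDeriv a K x μ β else 0 := by
  have hw : 1 - K * (x 1) ^ 2 ≠ 0 := hx.1.ne'
  have hA : HasDerivAt (fun t => -(a t) ^ 2) (-(2 * a (x 0) * deriv a (x 0))) (x 0) :=
    ((ha (x 0)).hasDerivAt.pow 2).neg.congr_deriv (by norm_num)
  have h1 := hasDerivAt_const (x 2) (1 : ℝ)
  have e1 := pdx_separable hA ((hasDerivAt_one_sub_mul_sq K (x 1)).inv hw) h1 μ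
  have e2 := pdx_separable hA (hasDerivAt_sq (x 1)) h1 μ
  have e3 := pdx_separable hA (hasDerivAt_sq (x 1)) (hasDerivAt_sin_sq (x 2)) μ
  split_ifs with h
  · subst h
    fin_cases β
    · fin_cases μ <;> simp [rwMetric, rwMetricDeriv]
    · refine Eq.trans (congrArg (pdx μ · x) ?_) (e1.trans ?_)
      · ext y; simp [rwMetric, div_eq_mul_inv]
      · fin_cases μ <;> simp [rwMetricDeriv] <;> field_simp
    · refine Eq.trans (congrArg (pdx μ · x) ?_) (e2.trans ?_)
      · ext y; simp [rwMetric]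
      · fin_cases μ <;> simp [rwMetricDeriv]
    · refine Eq.trans (congrArg (pdx μ · x) ?_) (e3.trans ?_)
      · ext y; simp [rwMetric]
      · fin_cases μ <;> simp [rwMetricDeriv]
  · simp [rwMetric, Matrix.diagonal_apply_ne _ h]

theorem rwMetric_inv {a : ℝ → ℝ} {K : ℝ} (hapos : ∀ t, 0 < a t) {x : Fin 4 → ℝ}
    (hx : x ∈ rwDomain K) :
    (rwMetric a K x)⁻¹ = Matrix.diagonal
      ![1, -(1 - K * (x 1) ^ 2) / (a (x 0)) ^ 2, -1 / ((a (x 0)) ^ 2 * (x 1) ^ 2),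
        -1 / ((a (x 0)) ^ 2 * (x 1) ^ 2 * Real.sin (x 2) ^ 2)] := by
  have hw : 1 - K * (x 1) ^ 2 ≠ 0 := hx.1.ne'
  have hr : x 1 ≠ 0 := hx.2.1.ne'
  have hs : Real.sin (x 2) ≠ 0 := (Real.sin_pos_of_mem_Ioo hx.2.2).ne'
  have hA : a (x 0) ≠ 0 := (hapos _).ne'
  apply Matrix.inv_eq_right_inv
  rw [rwMetric, Matrix.diagonal_mul_diagonal, ← Matrix.diagonal_one]
  congr 1
  ext i
  fin_cases i <;> simp <;> field_simp; ring1

set_option maxHeartbeats 4000000 in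
theorem christoffel_rwMetric {a : ℝ → ℝ} {K : ℝ} (ha : Differentiable ℝ a)
    (hapos : ∀ t, 0 < a t) {x : Fin 4 → ℝ} (hx : x ∈ rwDomain K) (ρ β μ : Fin 4) :
    christoffel (rwMetric a K) x ρ β μ = rwChristoffel a K x ρ β μ := by
  have hw : 1 - K * (x 1) ^ 2 ≠ 0 := hx.1.ne'
  have hr : x 1 ≠ 0 := hx.2.1.ne'
  have hs : Real.sin (x 2) ≠ 0 := (Real.sin_pos_of_mem_Ioo hx.2.2).ne'
  have hA : a (x 0) ≠ 0 := (hapos _).ne'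
  simp only [christoffel, pdx_rwMetric ha hx, rwMetric_inv hapos hx]
  rw [Finset.sum_eq_single ρ (fun α _ h => by rw [Matrix.diagonal_apply_ne' _ h, zero_mul])
    (by simp), Matrix.diagonal_apply_eq]
  fin_cases ρ <;> fin_cases β <;> fin_cases μ <;>
    simp [rwMetricDeriv, rwChristoffel] <;> field_simp <;> ring1

/-- `rwChristoffelDeriv a K x ν ρ β μ` is the partial derivative ∂_ν Γ^ρ_{βμ} of the
Christoffel symbols of the Robertson–Walker metric. -/
noncomputable def rwChristoffelDeriv (a : ℝ → ℝ) (K : ℝ) (x : Fin 4 → ℝ) (ν : Fin 4) :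
    Fin 4 → Matrix (Fin 4) (Fin 4) ℝ :=
  let A := a (x 0)
  let A' := deriv a (x 0)
  let B := A' ^ 2 + A * deriv (deriv a) (x 0)
  let H := ![(deriv (deriv a) (x 0) * A - A' ^ 2) / A ^ 2, 0, 0, 0] ν
  let r := x 1
  let s := Real.sin (x 2)
  let c := Real.cos (x 2)
  let w := 1 - K * r ^ 2
  let R := ![0, -1 / r ^ 2, 0, 0] ν
  let C := ![0, 0, -1 / s ^ 2, 0] ν
  ![!![0, 0, 0, 0;
       0, ![B / w, A * A' * (2 * K * r) / w ^ 2, 0, 0] ν, 0, 0;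
       0, 0, ![B * r ^ 2, A * A' * (2 * r), 0, 0] ν, 0;
       0, 0, 0, ![B * r ^ 2 * s ^ 2, A * A' * (2 * r) * s ^ 2,
         A * A' * r ^ 2 * (2 * s * c), 0] ν],
    !![0, H, 0, 0;
       H, ![0, K * (1 + K * r ^ 2) / w ^ 2, 0, 0] ν, 0, 0;
       0, 0, ![0, 3 * K * r ^ 2 - 1, 0, 0] ν, 0;
       0, 0, 0, ![0, (3 * K * r ^ 2 - 1) * s ^ 2, -(r * w) * (2 * s * c), 0] ν],
    !![0, 0, H, 0;
       0, 0, R, 0;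
       H, R, 0, 0;
       0, 0, 0, ![0, 0, s ^ 2 - c ^ 2, 0] ν],
    !![0, 0, 0, H;
       0, 0, 0, R;
       0, 0, 0, C;
       H, R, C, 0]]

set_option maxHeartbeats 4000000 in
theorem pdx_rwChristoffel {a : ℝ → ℝ} {K : ℝ} (ha : Differentiable ℝ a)
    (ha' : Differentiable ℝ (deriv a)) (hapos : ∀ t, 0 < a t) {x : Fin 4 → ℝ}
    (hx : x ∈ rwDomain K) (ν ρ β μ : Fin 4) :
    pdx ν (fun y => rwChristoffel a K y ρ β μ) x = rwChristoffelDeriv a K x ν ρ β μ := by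
  have hw : 1 - K * (x 1) ^ 2 ≠ 0 := hx.1.ne'
  have hr : x 1 ≠ 0 := hx.2.1.ne'
  have hs : Real.sin (x 2) ≠ 0 := (Real.sin_pos_of_mem_Ioo hx.2.2).ne'
  have hA : a (x 0) ≠ 0 := (hapos _).ne'
  have one (i : Fin 4) := hasDerivAt_const (x i) (1 : ℝ)
  have d0 := (ha (x 0)).hasDerivAt
  have d1 := (ha' (x 0)).hasDerivAt
  have dw := hasDerivAt_one_sub_mul_sq K (x 1)
  have drw := ((hasDerivAt_id (x 1)).mul dw).neg
  have dsc := ((Real.hasDerivAt_sin (x 2)).mul (Real.hasDerivAt_cos (x 2))).neg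
  have dcs := (Real.hasDerivAt_cos (x 2)).div (Real.hasDerivAt_sin (x 2)) hs
  have e1 := pdx_separable (d0.mul d1) (dw.inv hw) (one 2) ν
  have e2 := pdx_separable (d0.mul d1) (hasDerivAt_sq (x 1)) (one 2) ν
  have e3 := pdx_separable (d0.mul d1) (hasDerivAt_sq (x 1)) (hasDerivAt_sin_sq (x 2)) ν
  have e4 := pdx_separable (d1.div d0 hA) (one 1) (one 2) ν
  have e5 := pdx_separable (one 0) (((hasDerivAt_id (x 1)).const_mul K).div dw hw) (one 2) ν
  have e6 := pdx_separable (one 0) drw (one 2) ν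
  have e7 := pdx_separable (one 0) drw (hasDerivAt_sin_sq (x 2)) ν
  have e8 := pdx_separable (one 0) (hasDerivAt_inv hr) (one 2) ν
  have e9 := pdx_separable (one 0) (one 1) dsc ν
  have e10 := pdx_separable (one 0) (one 1) dcs ν
  simp only [Pi.mul_apply, Pi.inv_apply, Pi.div_apply, Pi.neg_apply, id, one_mul, mul_one,
    ← div_eq_mul_inv] at e1 e2 e3 e4 e5 e6 e7 e8 e9 e10
  have hcs := Real.sin_sq_add_cos_sq (x 2)
  fin_cases ρ <;> fin_cases β <;> fin_cases μ <;>
    simp only [rwChristoffel, rwChristoffelDeriv, Fin.zero_eta, Fin.mk_one,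
      Fin.reduceFinMk, Matrix.of_apply, Matrix.cons_val, pdx_const,
      e1, e2, e3, e4, e5, e6, e7, e8, e9, e10] <;>
    clear e1 e2 e3 e4 e5 e6 e7 e8 e9 e10 <;>
    fin_cases ν <;>
    simp only [Fin.zero_eta, Fin.mk_one, Fin.reduceFinMk, Matrix.cons_val, mul_zero, zero_mul,
      zero_div] <;>
    field_simp <;> first | ring1 | linear_combination hcs | linear_combination -hcs

set_option maxHeartbeats 4000000 in
/-- The curvature tensor of the Robertson–Walker metric has the form
R^σ_{μνρ} = ψ^{σρ}(δ_{μσ}δ_{νρ} − δ_{μρ}δ_{νσ}). -/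
theorem robertson_walker_curvature (a : ℝ → ℝ) (K : ℝ)
    (ha : ContDiff ℝ (⊤ : ℕ∞) a) (hapos : ∀ t : ℝ, 0 < a t) :
    ∀ x : Fin 4 → ℝ, 0 < 1 - K * (x 1) ^ 2 → 0 < x 1 → x 2 ∈ Set.Ioo 0 Real.pi →
      ∀ σ μ ν ρ : Fin 4,
        riemann (rwMetric a K) x σ μ ν ρ
          = rwPsi a K x σ ρ * (kd μ σ * kd ν ρ - kd μ ρ * kd ν σ) := by
  intro x hw hr hθ σ μ ν ρ
  have hx : x ∈ rwDomain K := ⟨hw, hr, hθ⟩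
  have hd : Differentiable ℝ a := ha.differentiable (by simp)
  have hd' : Differentiable ℝ (deriv a) :=
    (contDiff_infty_iff_deriv.1 ha).2.differentiable (by simp)
  have hG (i j k : Fin 4) : (fun y => christoffel (rwMetric a K) y i j k) =ᶠ[nhds x]
      fun y => rwChristoffel a K y i j k := by
    filter_upwards [(isOpen_rwDomain K).mem_nhds hx] with y hy
    exact christoffel_rwMetric hd hapos hy i j k
  have hw' : 1 - K * (x 1) ^ 2 ≠ 0 := hw.ne'
  have hw_comm : 1 - (x 1) ^ 2 * K ≠ 0 := by rwa [mul_comm]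
  have hr' : x 1 ≠ 0 := hr.ne'
  have hs : Real.sin (x 2) ≠ 0 := (Real.sin_pos_of_mem_Ioo hθ).ne'
  have hA : a (x 0) ≠ 0 := (hapos _).ne'
  have hcs : Real.cos (x 2) ^ 2 = 1 - Real.sin (x 2) ^ 2 := Real.cos_sq' _
  simp only [riemann, pdx_congr_of_eventuallyEq (hG _ _ _), pdx_rwChristoffel hd hd' hapos hx,
    christoffel_rwMetric hd hapos hx, Fin.sum_univ_four]
  fin_cases σ <;> fin_cases μ <;> fin_cases ν <;> fin_cases ρ <;>
    simp [rwChristoffel, rwChristoffelDeriv, rwPsi, rwMetric, kd] <;> field_simp <;>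
    (try simp only [hcs]) <;> ring1
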